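/- arXiv:math/9911216 — 11 statements merged into one kernel-verified Lean document; each statement's English description precedes it below -/
import Mathlib

section
/- Let τ be an infinite cardinal, let A be a τ-complete directed partially ordered set, and let {A_t : t ∈ T} be a family of subsets of A indexed by a set T with |T| ≤ τ such that each A_t is both cofinal and τ-closed in A. Then the intersection ⋂{A_t : t ∈ T} is cofinal (in particular, non-empty) and τ-closed in A. -/
open Cardinal

universe u

/-- A directed partially ordered set `A` is `τ`-complete if every chain of
cardinality at most `τ` has a least upper bound in `A`. -/
def TauComplete (τ : Cardinal.{u}) (A : Type u) [PartialOrder A] : Prop :=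
  ∀ C : Set A, IsChain (· ≤ ·) C → #C ≤ τ → ∃ s : A, IsLUB C s

/-- A subset `B` of `A` is cofinal if every element of `A` is majorated by an
element of `B`. -/
def CofinalIn {A : Type u} [PartialOrder A] (B : Set A) : Prop :=
  ∀ a : A, ∃ b ∈ B, a ≤ b

/-- A subset `B` of `A` is `τ`-closed if for every chain `C ⊆ B` of cardinality
at most `τ`, the least upper bound of `C` belongs to `B` whenever it exists in `A`. -/
def TauClosedIn (τ : Cardinal.{u}) {A : Type u} [PartialOrder A] (B : Set A) : Prop :=
  ∀ C : Set A, C ⊆ B → IsChain (· ≤ ·) C → #C ≤ τ → ∀ s : A, IsLUB C s → s ∈ B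

theorem TauComplete.exists_upper_bound {τ : Cardinal.{u}} {A : Type u} [PartialOrder A]
    (hcomp : TauComplete τ A) {C : Set A} (hC : IsChain (· ≤ ·) C) (hcard : #C ≤ τ)
    {a : A} (ha : ∀ c ∈ C, a ≤ c) : ∃ x, a ≤ x ∧ ∀ c ∈ C, c ≤ x := by
  rcases C.eq_empty_or_nonempty with rfl | ⟨c, hc⟩
  · exact ⟨a, le_rfl, by simp⟩
  · obtain ⟨s, hs⟩ := hcomp C hC hcard
    exact ⟨s, (ha c hc).trans (hs.1 hc), fun d hd => hs.1 hd⟩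

/-- Every family of at most `τ` cofinal sets, indexed by a well-order, has an increasing
selection above any given element. -/
theorem TauComplete.exists_monotone_selection {τ : Cardinal.{u}} {A : Type u} [PartialOrder A]
    (hcomp : TauComplete τ A) {T : Type u} [LinearOrder T] [WellFoundedLT T] (hT : #T ≤ τ)
    (F : T → Set A) (hcof : ∀ t, CofinalIn (F t)) (a : A) :
    ∃ f : T → A, Monotone f ∧ ∀ t, f t ∈ F t ∧ a ≤ f t := by
  classical
  let step (t : T) (g : ∀ s, s < t → A) : A :=
    if h : ∃ x ∈ F t, a ≤ x ∧ ∀ s hs, g s hs ≤ x then h.choose else a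
  let f : T → A := (wellFounded_lt (α := T)).fix step
  have hf : ∀ t, f t = step t fun s _ => f s := fun t => WellFounded.fix_eq _ step t
  have key : ∀ t, f t ∈ F t ∧ a ≤ f t ∧ ∀ s < t, f s ≤ f t := by
    intro t
    induction t using WellFoundedLT.induction with
    | ind t ih =>
      have hex : ∃ x ∈ F t, a ≤ x ∧ ∀ s, s < t → f s ≤ x := by
        have hchain : IsChain (· ≤ ·) (f '' Set.Iio t) := by
          rintro _ ⟨r, hr, rfl⟩ _ ⟨s, hs, rfl⟩ -
          rcases lt_trichotomy r s with h | rfl | h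
          · exact Or.inl ((ih s hs).2.2 r h)
          · exact Or.inl le_rfl
          · exact Or.inr ((ih r hr).2.2 s h)
        obtain ⟨y, hay, hy⟩ := hcomp.exists_upper_bound hchain
          ((mk_image_le.trans (mk_set_le _)).trans hT) (a := a)
          (by rintro _ ⟨s, hs, rfl⟩; exact (ih s hs).2.1)
        obtain ⟨x, hx, hyx⟩ := hcof t y
        exact ⟨x, hx, hay.trans hyx, fun s hs => (hy _ ⟨s, hs, rfl⟩).trans hyx⟩
      have heq : f t = hex.choose := (hf t).trans (dif_pos hex)
      rw [heq]
      exact hex.choose_spec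
  refine ⟨f, fun s t hst => ?_, fun t => ⟨(key t).1, (key t).2.1⟩⟩
  rcases hst.eq_or_lt with rfl | h
  · exact le_rfl
  · exact (key t).2.2 s h

theorem TauComplete.exists_interpolating {τ : Cardinal.{u}} {A : Type u} [PartialOrder A]
    (hcomp : TauComplete τ A) {T : Type u} (hT : #T ≤ τ)
    (F : T → Set A) (hcof : ∀ t, CofinalIn (F t)) (a : A) :
    ∃ b, a ≤ b ∧ ∀ t, ∃ c ∈ F t, a ≤ c ∧ c ≤ b := by
  obtain ⟨_, _⟩ := exists_wellFoundedLT T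
  obtain ⟨f, hmono, hf⟩ := hcomp.exists_monotone_selection hT F hcof a
  obtain ⟨b, hab, hb⟩ := hcomp.exists_upper_bound hmono.isChain_range (mk_range_le.trans hT)
    (a := a) (by rintro _ ⟨t, rfl⟩; exact (hf t).2)
  exact ⟨b, hab, fun t => ⟨f t, (hf t).1, (hf t).2, hb _ ⟨t, rfl⟩⟩⟩

theorem tauClosedIn_iInter {τ : Cardinal.{u}} {A : Type u} [PartialOrder A] {T : Type u}
    {F : T → Set A} (hcl : ∀ t, TauClosedIn τ (F t)) : TauClosedIn τ (⋂ t, F t) :=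
  fun C hC hchain hcard s hs => Set.mem_iInter.2 fun t =>
    hcl t C (hC.trans (Set.iInter_subset F t)) hchain hcard s hs

theorem cofinal_tauClosed_inter {τ : Cardinal.{u}} (hτ : ℵ₀ ≤ τ)
    {A : Type u} [PartialOrder A] (hdir : ∀ a b : A, ∃ c : A, a ≤ c ∧ b ≤ c)
    (hcomp : TauComplete τ A)
    {T : Type u} (hT : #T ≤ τ) (F : T → Set A)
    (hcof : ∀ t : T, CofinalIn (F t)) (hcl : ∀ t : T, TauClosedIn τ (F t)) :
    CofinalIn (⋂ t : T, F t) ∧ TauClosedIn τ (⋂ t : T, F t) := by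
  refine ⟨fun a => ?_, tauClosedIn_iInter hcl⟩
  choose next hle mid hmem hlo hhi using hcomp.exists_interpolating hT F hcof
  let u : ℕ → A := fun n => next^[n] a
  have hsucc : ∀ n, u (n + 1) = next (u n) := fun n => Function.iterate_succ_apply' next n a
  have hu : Monotone u := monotone_nat_of_le_succ fun n => (hle (u n)).trans_eq (hsucc n).symm
  have hcard : ∀ v : ℕ → A, #(Set.range v) ≤ τ := fun v =>
    (Set.countable_range v).le_aleph0.trans hτ
  obtain ⟨s, hs⟩ := hcomp _ hu.isChain_range (hcard u)
  refine ⟨s, Set.mem_iInter.2 fun t => ?_, hs.1 ⟨0, rfl⟩⟩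
  let v : ℕ → A := fun n => mid (u n) t
  have hvu : ∀ n, v n ≤ u (n + 1) := fun n => (hhi (u n) t).trans_eq (hsucc n).symm
  have hv : Monotone v := monotone_nat_of_le_succ fun n => (hvu n).trans (hlo (u (n + 1)) t)
  refine hcl t (Set.range v) ?_ hv.isChain_range (hcard v) s ⟨?_, fun x hx => hs.2 ?_⟩
  · rintro _ ⟨n, rfl⟩
    exact hmem (u n) t
  · rintro _ ⟨n, rfl⟩
    exact (hvu n).trans (hs.1 ⟨n + 1, rfl⟩)
  · rintro _ ⟨n, rfl⟩
    exact (hlo (u n) t).trans (hx ⟨n, rfl⟩)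
end

section
/- Let τ be an infinite cardinal and let A be a τ-complete directed partially ordered set. Then every subset B ⊆ A with |B| ≤ τ has an upper bound in A, i.e., there exists γ ∈ A with γ ≥ β for every β ∈ B. -/
open Cardinal

universe u

/-- If all sets of cardinality less than the infinite cardinal `#B` are bounded above, then
some chain of cardinality at most `#B` dominates every element of `B`. -/
theorem exists_isChain_dominating {A : Type u} [PartialOrder A] (B : Set A) (hB : ℵ₀ ≤ #B)
    (hsmall : ∀ S : Set A, #S < #B → BddAbove S) :
    ∃ C : Set A, IsChain (· ≤ ·) C ∧ #C ≤ #B ∧ ∀ b ∈ B, ∃ c ∈ C, b ≤ c := by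
  classical
  obtain ⟨e⟩ : Nonempty ((#B).ord.ToType ≃ B) := Cardinal.eq.1 (mk_ord_toType _)
  have hub : ∀ S : Set A, ∃ a : A, #S < #B → a ∈ upperBounds S := by
    intro S
    by_cases hS : #S < #B
    · exact (hsmall S hS).imp fun a ha _ => ha
    · obtain ⟨a, -⟩ := hsmall ∅ (by simpa using aleph0_pos.trans_le hB)
      exact ⟨a, fun h => absurd h hS⟩
  choose ub hub using hub
  have hwf : WellFounded ((· < ·) : (#B).ord.ToType → (#B).ord.ToType → Prop) := wellFounded_lt
  let g : (#B).ord.ToType → A :=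
    hwf.fix fun i ih => ub (insert (e i : A) (Set.range fun j : Set.Iio i => ih j.1 j.2))
  have hg : ∀ i, g i = ub (insert (e i : A) (Set.range fun j : Set.Iio i => g j)) :=
    fun i => hwf.fix_eq _ i
  have hbound : ∀ i, g i ∈ upperBounds (insert (e i : A) (Set.range fun j : Set.Iio i => g j)) := by
    intro i
    rw [hg i]
    refine hub _ (mk_insert_le.trans_lt ?_)
    exact add_lt_of_lt hB (mk_range_le.trans_lt (by simpa using mk_Iio_lt i))
      (one_lt_aleph0.trans_le hB)
  have hmono : Monotone g := by
    refine monotone_iff_forall_lt.2 fun j i hji => hbound i ?_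
    exact Set.mem_insert_of_mem _ ⟨⟨j, hji⟩, rfl⟩
  refine ⟨Set.range g, hmono.isChain_range, mk_range_le.trans (mk_ord_toType _).le, ?_⟩
  intro b hb
  refine ⟨_, Set.mem_range_self (e.symm ⟨b, hb⟩), hbound _ ?_⟩
  simp

theorem exists_upperBound_of_card_le {τ : Cardinal.{u}} (hτ : ℵ₀ ≤ τ)
    {A : Type u} [PartialOrder A] (hdir : ∀ a b : A, ∃ c : A, a ≤ c ∧ b ≤ c)
    (hcomp : TauComplete τ A)
    (B : Set A) (hB : #B ≤ τ) :
    ∃ γ : A, ∀ β ∈ B, β ≤ γ := by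
  suffices h : ∀ κ ≤ τ, ∀ S : Set A, #S = κ → BddAbove S from h _ hB B rfl
  intro κ
  induction κ using WellFoundedLT.induction with
  | ind κ ih =>
  rintro hκ S rfl
  rcases lt_or_ge #S ℵ₀ with hfin | hinf
  · obtain ⟨a, -⟩ := hcomp ∅ (by simp) (by simp)
    have : Nonempty A := ⟨a⟩
    have : IsDirectedOrder A := ⟨hdir⟩
    exact (lt_aleph0_iff_set_finite.1 hfin).bddAbove
  · obtain ⟨C, hC, hcard, hcof⟩ := exists_isChain_dominating S hinf fun T hT =>
      ih _ hT (hT.le.trans hκ) T rfl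
    obtain ⟨s, hs⟩ := hcomp C hC (hcard.trans hκ)
    refine ⟨s, fun b hb => ?_⟩
    obtain ⟨c, hc, hbc⟩ := hcof b hb
    exact hbc.trans (hs.1 hc)
end

section
/- Let τ be an infinite cardinal, let A be a τ-complete directed partially ordered set, and let L ⊆ A × A be a relation satisfying: (Existence) for each α ∈ A there exists β ∈ A with (α, β) ∈ L; (Majorantness) if (α, β) ∈ L and γ ≥ β then (α, γ) ∈ L; (τ-closeness) if {α_t : t ∈ T} is a chain in A with |T| ≤ τ, β ∈ A, and (α_t, β) ∈ L for every t ∈ T, then (α, β) ∈ L where α = sup{α_t : t ∈ T}. Then the set {α ∈ A : (α, α) ∈ L} is cofinal and τ-closed in A. -/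
open Cardinal

universe u

theorem diagonal_cofinal_tauClosed {τ : Cardinal.{u}} (hτ : ℵ₀ ≤ τ)
    {A : Type u} [PartialOrder A] (hdir : ∀ a b : A, ∃ c : A, a ≤ c ∧ b ≤ c)
    (hcomp : TauComplete τ A)
    (L : A → A → Prop)
    (hexist : ∀ α : A, ∃ β : A, L α β)
    (hmaj : ∀ α β γ : A, L α β → β ≤ γ → L α γ)
    (hclosed : ∀ C : Set A, IsChain (· ≤ ·) C → #C ≤ τ → ∀ β : A,
      (∀ c ∈ C, L c β) → ∀ s : A, IsLUB C s → L s β) :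
    CofinalIn {α : A | L α α} ∧ TauClosedIn τ {α : A | L α α} := by
  refine ⟨fun a => ?_, fun C hCB hC hCτ s hs => ?_⟩
  · have hstep : ∀ x : A, ∃ y : A, x ≤ y ∧ L x y := fun x => by
      obtain ⟨β, hβ⟩ := hexist x
      obtain ⟨c, hxc, hβc⟩ := hdir x β
      exact ⟨c, hxc, hmaj x β c hβ hβc⟩
    choose f hle hL using hstep
    have hmono : Monotone fun n : ℕ => f^[n] a :=
      monotone_nat_of_le_succ fun n => by
        rw [Function.iterate_succ_apply']
        exact hle _
    have hchain : IsChain (· ≤ ·) (Set.range fun n : ℕ => f^[n] a) := hmono.isChain_range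
    have hcard : #(Set.range fun n : ℕ => f^[n] a) ≤ τ :=
      (Cardinal.mk_le_aleph0_iff.2 (Set.countable_range _)).trans hτ
    obtain ⟨s, hs⟩ := hcomp _ hchain hcard
    refine ⟨s, hclosed _ hchain hcard s ?_ s hs, hs.1 ⟨0, rfl⟩⟩
    rintro _ ⟨n, rfl⟩
    refine hmaj _ _ s (hL _) (hs.1 ⟨n + 1, ?_⟩)
    exact Function.iterate_succ_apply' f n a
  · exact hclosed C hC hCτ s (fun c hc => hmaj c c s (hCB hc) (hs.1 hc)) s hs
end

section
/- Let (A_t)_{t ∈ T} be an arbitrary family of unital C*-algebras such that each A_t has real rank zero. Then the ℓ∞-product ∏_{t ∈ T} A_t (the C*-algebra of all bounded families (x_t)_{t ∈ T} with x_t ∈ A_t, equipped with the supremum norm and coordinatewise operations; in Mathlib, lp (fun t => A t) ∞) has real rank zero. -/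
open ENNReal

/-- A unital C*-algebra (more generally, a normed star ring) has real rank zero if every
self-adjoint element can be approximated arbitrarily closely by invertible self-adjoint
elements. -/
def RealRankZero (X : Type*) [NormedRing X] [StarRing X] : Prop :=
  ∀ x : X, IsSelfAdjoint x → ∀ ε : ℝ, 0 < ε →
    ∃ y : X, IsSelfAdjoint y ∧ IsUnit y ∧ ‖x - y‖ < ε

/-- The function pushing a real number away from `0`, to absolute value at least `δ`. -/
noncomputable def pushAway (δ s : ℝ) : ℝ := if 0 < s then max s δ else min s (-δ)

lemma continuousOn_pushAway (δ : ℝ) : ContinuousOn (pushAway δ) {0}ᶜ := by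
  intro s hs
  apply ContinuousAt.continuousWithinAt
  rcases lt_or_gt_of_ne (show s ≠ 0 from hs) with h | h
  · refine ContinuousAt.congr (f := fun r => min r (-δ)) (by fun_prop) ?_
    filter_upwards [Iio_mem_nhds h] with r hr
    simp [pushAway, not_lt.2 (le_of_lt (show r < 0 from hr))]
  · refine ContinuousAt.congr (f := fun r => max r δ) (by fun_prop) ?_
    filter_upwards [Ioi_mem_nhds h] with r hr
    simp [pushAway, show 0 < r from hr]

lemma le_abs_pushAway {δ : ℝ} (s : ℝ) : δ ≤ |pushAway δ s| := by
  unfold pushAway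
  split_ifs
  · exact (le_max_right s δ).trans (le_abs_self _)
  · exact (le_neg_of_le_neg (min_le_right s (-δ))).trans (neg_le_abs _)

lemma abs_sub_pushAway_le {δ : ℝ} (hδ : 0 ≤ δ) (s : ℝ) : |s - pushAway δ s| ≤ δ := by
  unfold pushAway
  split_ifs <;> grind

/-- A self-adjoint invertible element can be perturbed by at most `δ` to a self-adjoint element
whose inverse has norm at most `δ⁻¹`. -/
lemma IsSelfAdjoint.exists_inverse_norm_le {A : Type*} [CStarAlgebra A] {a : A}
    (ha : IsSelfAdjoint a) (hu : IsUnit a) {δ : ℝ} (hδ : 0 < δ) :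
    ∃ y z : A, IsSelfAdjoint y ∧ y * z = 1 ∧ z * y = 1 ∧ ‖a - y‖ ≤ δ ∧ ‖z‖ ≤ δ⁻¹ := by
  have hne (s : ℝ) : pushAway δ s ≠ 0 := abs_pos.1 (hδ.trans_le (le_abs_pushAway s))
  have hc : ContinuousOn (pushAway δ) (spectrum ℝ a) :=
    (continuousOn_pushAway δ).mono fun s hs h0 => by
      rw [Set.mem_singleton_iff.1 h0] at hs
      exact spectrum.zero_notMem ℝ hu hs
  have hc' : ContinuousOn (fun s => (pushAway δ s)⁻¹) (spectrum ℝ a) := hc.inv₀ fun s _ => hne s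
  refine ⟨cfc (pushAway δ) a, cfc (fun s => (pushAway δ s)⁻¹) a, cfc_predicate _ a, ?_, ?_, ?_, ?_⟩
  · rw [← cfc_mul _ _ a hc hc', ← cfc_one ℝ a]
    exact cfc_congr fun s _ => mul_inv_cancel₀ (hne s)
  · rw [← cfc_mul _ _ a hc' hc, ← cfc_one ℝ a]
    exact cfc_congr fun s _ => inv_mul_cancel₀ (hne s)
  · have h : a - cfc (pushAway δ) a = cfc (fun s => s - pushAway δ s) a := by
      rw [cfc_sub (fun s => s) _ a continuousOn_id hc, cfc_id' ℝ a]
    rw [h]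
    exact norm_cfc_le hδ.le fun s _ => abs_sub_pushAway_le hδ.le s
  · refine norm_cfc_le (inv_nonneg.2 hδ.le) fun s _ => ?_
    rw [norm_inv]
    exact inv_anti₀ hδ (le_abs_pushAway s)

theorem realRankZero_lp_infty {T : Type*} (A : T → Type*)
    [∀ t, CStarAlgebra (A t)] [∀ t, Nontrivial (A t)]
    (h : ∀ t, RealRankZero (A t)) :
    RealRankZero (lp (fun t => A t) ∞) := by
  intro x hx ε hε
  have hδ : 0 < ε / 3 := by positivity
  have key (t : T) : ∃ y z : A t, IsSelfAdjoint y ∧ y * z = 1 ∧ z * y = 1 ∧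
      ‖x t - y‖ ≤ 2 * (ε / 3) ∧ ‖z‖ ≤ (ε / 3)⁻¹ := by
    have hxt : IsSelfAdjoint (x t) := congrFun (congrArg Subtype.val hx) t
    obtain ⟨a, ha, hu, hxa⟩ := h t (x t) hxt (ε / 3) hδ
    obtain ⟨y, z, hy, hyz, hzy, hay, hz⟩ := ha.exists_inverse_norm_le hu hδ
    refine ⟨y, z, hy, hyz, hzy, ?_, hz⟩
    linarith [norm_sub_le_norm_sub_add_norm_sub (x t) a y]
  choose y z hy hyz hzy hxy hz using key
  have hymem : Memℓp y ∞ := by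
    refine memℓp_infty ⟨‖x‖ + 2 * (ε / 3), ?_⟩
    rintro _ ⟨t, rfl⟩
    have h₁ := norm_le_norm_add_norm_sub (x t) (y t)
    have h₂ := lp.norm_apply_le_norm ENNReal.top_ne_zero x t
    linarith [hxy t]
  have hzmem : Memℓp z ∞ := memℓp_infty ⟨(ε / 3)⁻¹, by rintro _ ⟨t, rfl⟩; exact hz t⟩
  let Y : lp (fun t => A t) ∞ := ⟨y, hymem⟩
  let Z : lp (fun t => A t) ∞ := ⟨z, hzmem⟩
  refine ⟨Y, Subtype.ext (funext hy), ⟨⟨Y, Z, Subtype.ext (funext hyz),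
    Subtype.ext (funext hzy)⟩, rfl⟩, ?_⟩
  exact (lp.norm_le_of_forall_le (by positivity) hxy).trans_lt (by linarith)
end

section
/- There exists a separable unital C*-algebra Z of real rank zero which is universal for the class of all separable unital C*-algebras of real rank zero: for every separable unital C*-algebra X of real rank zero there exists a surjective unital *-homomorphism from Z onto X. -/
open scoped ENNReal

/-- The identity can be pushed away from zero, continuously outside of zero. -/
theorem exists_continuousOn_compl_zero_le_abs {δ : ℝ} (hδ : 0 < δ) :
    ∃ g : ℝ → ℝ, ContinuousOn g {0}ᶜ ∧ ∀ t ≠ 0, δ ≤ |g t| ∧ |t - g t| ≤ δ := by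
  refine ⟨fun t ↦ t * max 1 (δ / |t|), ?_, fun t ht ↦ ?_⟩
  · exact continuousOn_id.mul (continuousOn_const.sup
      (continuousOn_const.div continuous_abs.continuousOn fun t ht ↦ abs_ne_zero.2 ht))
  have h := abs_pos.2 ht
  have hmax : |t| * max 1 (δ / |t|) = max |t| δ := by
    rw [mul_max_of_nonneg _ _ h.le, mul_one, mul_div_cancel₀ _ h.ne']
  have h1 : 1 ≤ max 1 (δ / |t|) := le_max_left _ _
  constructor
  · rw [abs_mul, abs_of_pos (one_pos.trans_le h1), hmax]
    exact le_max_right _ _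
  · rw [show t - t * max 1 (δ / |t|) = t * (1 - max 1 (δ / |t|)) by ring, abs_mul,
      abs_of_nonpos (sub_nonpos.2 h1), neg_sub, mul_sub, hmax, mul_one]
    rcases max_cases |t| δ with h | h <;> linarith

namespace RealRankZero

/-- In a C*-algebra of real rank zero the approximating invertible can be chosen with a bound on
the norm of its inverse which depends only on the quality of the approximation. -/
theorem exists_norm_inv_le {X : Type*} [CStarAlgebra X] (hX : RealRankZero X) {x : X}
    (hx : IsSelfAdjoint x) {ε : ℝ} (hε : 0 < ε) :
    ∃ y z : X, IsSelfAdjoint y ∧ y * z = 1 ∧ z * y = 1 ∧ ‖x - y‖ ≤ ε ∧ ‖z‖ ≤ (ε / 2)⁻¹ := by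
  obtain ⟨y₀, hy₀, hu, hxy⟩ := hX x hx (ε / 2) (half_pos hε)
  have h0 : ∀ t ∈ spectrum ℝ y₀, t ≠ 0 := fun t ht h ↦
    spectrum.zero_notMem ℝ hu (h ▸ ht)
  obtain ⟨g, hgc, hg⟩ := exists_continuousOn_compl_zero_le_abs (half_pos hε)
  replace hgc : ContinuousOn g (spectrum ℝ y₀) := hgc.mono h0
  have hg0 : ∀ t ∈ spectrum ℝ y₀, g t ≠ 0 := fun t ht ↦
    abs_pos.1 ((half_pos hε).trans_le (hg t (h0 t ht)).1)
  have hgi : ContinuousOn (fun t ↦ (g t)⁻¹) (spectrum ℝ y₀) := hgc.inv₀ hg0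
  refine ⟨cfc g y₀, cfc (fun t ↦ (g t)⁻¹) y₀, cfc_predicate g y₀, ?_, ?_, ?_, ?_⟩
  · rw [← cfc_mul g (fun t ↦ (g t)⁻¹) y₀ hgc hgi, ← cfc_one ℝ y₀]
    exact cfc_congr fun t ht ↦ mul_inv_cancel₀ (hg0 t ht)
  · rw [← cfc_mul (fun t ↦ (g t)⁻¹) g y₀ hgi hgc, ← cfc_one ℝ y₀]
    exact cfc_congr fun t ht ↦ inv_mul_cancel₀ (hg0 t ht)
  · have : ‖y₀ - cfc g y₀‖ ≤ ε / 2 := by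
      nth_rw 1 [← cfc_id' ℝ y₀]
      rw [← cfc_sub (fun t ↦ t) g y₀ continuousOn_id hgc]
      exact norm_cfc_le (half_pos hε).le fun t ht ↦ (hg t (h0 t ht)).2
    linarith [norm_sub_le_norm_sub_add_norm_sub x y₀ (cfc g y₀)]
  · refine norm_cfc_le (by positivity) fun t ht ↦ ?_
    rw [norm_inv, Real.norm_eq_abs]
    exact inv_anti₀ (half_pos hε) (hg t (h0 t ht)).1

end RealRankZero

noncomputable instance lp.inftyCStarAlgebra {I : Type*} {A : I → Type*} [∀ i, CStarAlgebra (A i)]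
    [∀ i, Nontrivial (A i)] : CStarAlgebra (lp A ∞) where

/-- Evaluation at a coordinate, as a unital *-homomorphism on an `ℓ^∞`-product. -/
def lp.evalStarAlgHom {I : Type*} (A : I → Type*) [∀ i, CStarAlgebra (A i)]
    [∀ i, Nontrivial (A i)] (i : I) : lp A ∞ →⋆ₐ[ℂ] A i where
  toFun f := f i
  map_one' := rfl
  map_mul' _ _ := rfl
  map_zero' := rfl
  map_add' _ _ := rfl
  commutes' _ := rfl
  map_star' _ := rfl

namespace RealRankZero

/-- Real rank zero passes to `ℓ^∞`-products. -/
theorem lp_infty {I : Type*} {A : I → Type*} [∀ i, CStarAlgebra (A i)]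
    [∀ i, Nontrivial (A i)] (h : ∀ i, RealRankZero (A i)) : RealRankZero (lp A ∞) := by
  intro x hx ε hε
  have hxi : ∀ i, IsSelfAdjoint (x i) := fun i ↦ hx.map (lp.evalStarAlgHom A i)
  choose y z hy hyz hzy hxy hz using fun i ↦ (h i).exists_norm_inv_le (hxi i) (half_pos hε)
  have hym : Memℓp y ∞ := memℓp_infty ⟨‖x‖ + ε / 2, by
    rintro _ ⟨i, rfl⟩
    have h1 := lp.norm_apply_le_norm ENNReal.top_ne_zero x i
    have h2 := norm_sub_le (x i) (x i - y i)
    have h3 := hxy i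
    rw [sub_sub_cancel] at h2
    change ‖y i‖ ≤ _
    linarith⟩
  have hzm : Memℓp z ∞ := memℓp_infty ⟨(ε / 2 / 2)⁻¹, by
    rintro _ ⟨i, rfl⟩
    exact hz i⟩
  let Y : lp A ∞ := ⟨y, hym⟩
  let W : lp A ∞ := ⟨z, hzm⟩
  refine ⟨Y, lp.ext (funext fun i ↦ hy i),
    ⟨⟨Y, W, lp.ext (funext fun i ↦ hyz i), lp.ext (funext fun i ↦ hzy i)⟩, rfl⟩, ?_⟩
  refine (lp.norm_le_of_forall_le (half_pos hε).le fun i ↦ hxy i).trans_lt (half_lt_self hε)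

/-- Real rank zero is invariant under *-isomorphism. -/
theorem of_starAlgEquiv {X Y : Type*} [CStarAlgebra X] [CStarAlgebra Y] (e : X ≃⋆ₐ[ℂ] Y)
    (hY : RealRankZero Y) : RealRankZero X := by
  intro x hx ε hε
  obtain ⟨y, hy, hu, hxy⟩ := hY (e x) (hx.map e) ε hε
  refine ⟨e.symm y, hy.map e.symm, hu.map e.symm, ?_⟩
  rw [← StarAlgEquiv.norm_map e]
  simpa using hxy

end RealRankZero

/-- Every countable subset of a C*-algebra of real rank zero lies in a separable unital
C*-subalgebra of real rank zero. -/
theorem RealRankZero.exists_separable_starSubalgebra {P : Type*} [CStarAlgebra P]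
    (hP : RealRankZero P) {C : Set P} (hC : C.Countable) :
    ∃ S : StarSubalgebra ℂ P, ∃ _ : IsClosed (S : Set P), C ⊆ S ∧
      TopologicalSpace.SeparableSpace S ∧ RealRankZero S := by
  have hsa : ∀ c : P, IsSelfAdjoint ((2⁻¹ : ℂ) • (c + star c)) := fun c ↦ by
    simp [isSelfAdjoint_iff, add_comm]
  choose g hg hgu hgn using fun (c : P) (k : ℕ) ↦
    hP ((2⁻¹ : ℂ) • (c + star c)) (hsa c) (1 / (k + 1)) Nat.one_div_pos_of_nat
  obtain ⟨Q, hQ, hQd⟩ := TopologicalSpace.exists_countable_dense ℂ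
  let step : Set P → Set P := fun D ↦
    D ∪ Set.image2 (· + ·) D D ∪ Set.image2 (· * ·) D D ∪ star '' D ∪
      Set.image2 (· • ·) Q D ∪ Set.image2 g D Set.univ
  have hstep : ∀ D, D.Countable → (step D).Countable := fun D hD ↦
    ((((hD.union (hD.image2 hD _)).union (hD.image2 hD _)).union (hD.image _)).union
      (hQ.image2 hD _)).union (hD.image2 Set.countable_univ _)
  let D : ℕ → Set P := fun n ↦ step^[n] (insert 1 C)
  have hDs : ∀ n, D (n + 1) = step (D n) := fun n ↦ Function.iterate_succ_apply' _ _ _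
  have hDc : ∀ n, (D n).Countable := fun n ↦ by
    induction n with
    | zero => exact hC.insert 1
    | succ n ih => rw [hDs]; exact hstep _ ih
  have hDm : Monotone D := monotone_nat_of_le_succ fun n x hx ↦ by
    rw [hDs]; simp only [step, Set.mem_union]; tauto
  let U : Set P := ⋃ n, D n
  have hUc : U.Countable := Set.countable_iUnion hDc
  have hU0 : insert 1 C ⊆ U := Set.subset_iUnion D 0
  have hU : ∀ {x}, x ∈ U → ∃ n, x ∈ D n := Set.mem_iUnion.1
  have hU2 : ∀ {x y}, x ∈ U → y ∈ U → ∃ n, x ∈ D n ∧ y ∈ D n := fun hx hy ↦ by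
    obtain ⟨m, hm⟩ := hU hx
    obtain ⟨n, hn⟩ := hU hy
    exact ⟨max m n, hDm (le_max_left _ _) hm, hDm (le_max_right _ _) hn⟩
  have hUs : ∀ {n x}, x ∈ step (D n) → x ∈ U := fun {n x} hx ↦
    Set.mem_iUnion.2 ⟨n + 1, by rwa [hDs]⟩
  have hadd : ∀ x ∈ U, ∀ y ∈ U, x + y ∈ U := fun x hx y hy ↦ by
    obtain ⟨n, h1, h2⟩ := hU2 hx hy
    exact hUs (n := n) (.inl <| .inl <| .inl <| .inl <| .inr <| Set.mem_image2_of_mem h1 h2)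
  have hmul : ∀ x ∈ U, ∀ y ∈ U, x * y ∈ U := fun x hx y hy ↦ by
    obtain ⟨n, h1, h2⟩ := hU2 hx hy
    exact hUs (n := n) (.inl <| .inl <| .inl <| .inr <| Set.mem_image2_of_mem h1 h2)
  have hstar : ∀ x ∈ U, star x ∈ U := fun x hx ↦ by
    obtain ⟨n, h1⟩ := hU hx
    exact hUs (n := n) (.inl <| .inl <| .inr <| Set.mem_image_of_mem _ h1)
  have hsmul : ∀ q ∈ Q, ∀ x ∈ U, q • x ∈ U := fun q hq x hx ↦ by
    obtain ⟨n, h1⟩ := hU hx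
    exact hUs (n := n) (.inl <| .inr <| Set.mem_image2_of_mem hq h1)
  have hgU : ∀ x ∈ U, ∀ k, g x k ∈ U := fun x hx k ↦ by
    obtain ⟨n, h1⟩ := hU hx
    exact hUs (n := n) (.inr <| Set.mem_image2_of_mem h1 (Set.mem_univ k))
  have hsmul' : ∀ (c : ℂ), ∀ x ∈ closure U, c • x ∈ closure U := fun c x hx ↦
    map_mem_closure₂ continuous_smul (hQd c) hx hsmul
  have h1 : (1 : P) ∈ closure U := subset_closure (hU0 (Set.mem_insert _ _))
  let S : StarSubalgebra ℂ P :=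
    { carrier := closure U
      mul_mem' := fun ha hb ↦ map_mem_closure₂ continuous_mul ha hb hmul
      add_mem' := fun ha hb ↦ map_mem_closure₂ continuous_add ha hb hadd
      algebraMap_mem' := fun r ↦ by
        rw [Algebra.algebraMap_eq_smul_one]
        exact hsmul' r 1 h1
      star_mem' := fun ha ↦ map_mem_closure continuous_star ha hstar }
  have hS : IsClosed (S : Set P) := isClosed_closure
  refine ⟨S, hS, fun x hx ↦ subset_closure (hU0 (Set.mem_insert_of_mem _ hx)), ?_, ?_⟩
  · have : TopologicalSpace.IsSeparable (S : Set P) := hUc.isSeparable.closure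
    exact this.separableSpace
  · intro x hx ε hε
    obtain ⟨c, hcU, hc⟩ := Metric.mem_closure_iff.1 x.2 (ε / 2) (half_pos hε)
    obtain ⟨k, hk⟩ := exists_nat_one_div_lt (half_pos hε)
    have hy : g c k ∈ S := subset_closure (hgU c hcU k)
    refine ⟨⟨g c k, hy⟩, Subtype.ext (hg c k), S.coe_isUnit.1 (hgu c k), ?_⟩
    change ‖(x : P) - g c k‖ < ε
    have hx' : star (x : P) = x := congrArg Subtype.val hx
    have h2 : (x : P) - (2⁻¹ : ℂ) • (c + star c) =
        (2⁻¹ : ℂ) • ((x - c) + star ((x : P) - c)) := by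
      rw [star_sub, hx']
      module
    have h3 : ‖(x : P) - (2⁻¹ : ℂ) • (c + star c)‖ < ε / 2 := by
      rw [h2, norm_smul]
      have := norm_add_le ((x : P) - c) (star ((x : P) - c))
      rw [norm_star] at this
      rw [dist_eq_norm] at hc
      rw [norm_inv, Complex.norm_ofNat]
      linarith
    have := norm_sub_le_norm_sub_add_norm_sub (x : P) ((2⁻¹ : ℂ) • (c + star c)) (g c k)
    linarith [hgn c k]

/-- A C*-algebra structure can be transported along a bijection. -/
theorem Equiv.exists_cstarAlgebra_starAlgEquiv {T X : Type*} [CStarAlgebra X] (e : T ≃ X) :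
    ∃ _ : CStarAlgebra T, Nonempty (T ≃⋆ₐ[ℂ] X) := by
  let _ := e.ring
  let _ := e.algebra ℂ
  let _ := e.starRing
  let _ : NormedRing T := NormedRing.induced T X e.ringEquiv e.injective
  let _ : NormedAlgebra ℂ T := NormedAlgebra.induced ℂ T X (e.algEquiv ℂ)
  have hiso : Isometry e := fun _ _ ↦ rfl
  have : CompleteSpace T := (completeSpace_congr (e := e) hiso.isUniformEmbedding).2 inferInstance
  have : StarModule ℂ T := e.starModule ℂ
  have : CStarRing T := ⟨fun x ↦ by
    calc ‖e x‖ * ‖e x‖ ≤ ‖star (e x) * e x‖ := CStarRing.norm_mul_self_le _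
      _ = ‖e (star x * x)‖ := by
        congr 1
        rw [show e (star x * x) = e (star x) * e x from e.apply_symm_apply _,
          show e (star x) = star (e x) from e.apply_symm_apply _]⟩
  exact ⟨{}, ⟨{ e.ringEquiv with
    map_star' := fun x ↦ e.apply_symm_apply _
    map_smul' := fun c x ↦ e.apply_symm_apply _ }⟩⟩

/-- A bounded operator on a Banach space whose values approximate every vector of the target up to
half of its norm, with a norm control on the approximate preimages, is surjective. -/
theorem ContinuousLinearMap.surjective_of_approx_preimage {𝕜 E F : Type*}
    [NontriviallyNormedField 𝕜] [NormedAddCommGroup E] [NormedSpace 𝕜 E] [CompleteSpace E]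
    [NormedAddCommGroup F] [NormedSpace 𝕜 F] (f : E →L[𝕜] F) (C : ℝ) (hC : 0 ≤ C)
    (h : ∀ y, ∃ x, ‖y - f x‖ ≤ 1 / 2 * ‖y‖ ∧ ‖x‖ ≤ C * ‖y‖) : Function.Surjective f := by
  choose g hg hgn using h
  intro y
  let r : ℕ → F := fun n ↦ (fun y ↦ y - f (g y))^[n] y
  have hr : ∀ n, r (n + 1) = r n - f (g (r n)) := fun n ↦ Function.iterate_succ_apply' _ _ _
  have hrn : ∀ n, ‖r n‖ ≤ (1 / 2) ^ n * ‖y‖ := fun n ↦ by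
    induction n with
    | zero => simp [r]
    | succ n ih =>
      rw [hr, pow_succ', mul_assoc]
      exact (hg _).trans (by gcongr)
  have hsum : Summable fun n ↦ g (r n) := by
    refine .of_norm_bounded (g := fun n ↦ (1 / 2 : ℝ) ^ n * (C * ‖y‖))
      (summable_geometric_two.mul_right _) fun n ↦ ?_
    calc ‖g (r n)‖ ≤ C * ‖r n‖ := hgn _
      _ ≤ C * ((1 / 2) ^ n * ‖y‖) := by gcongr; exact hrn n
      _ = (1 / 2) ^ n * (C * ‖y‖) := by ring
  have hpart : ∀ n, f (∑ i ∈ Finset.range n, g (r i)) = y - r n := fun n ↦ by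
    induction n with
    | zero => simp [r]
    | succ n ih => rw [Finset.sum_range_succ, map_add, ih, hr]; abel
  have hr0 : Filter.Tendsto r Filter.atTop (nhds 0) := by
    refine squeeze_zero_norm hrn ?_
    simpa using (tendsto_pow_atTop_nhds_zero_of_lt_one (r := (1 / 2 : ℝ)) (by norm_num)
      (by norm_num)).mul_const ‖y‖
  refine ⟨∑' n, g (r n), tendsto_nhds_unique
    ((f.continuous.tendsto _).comp hsum.hasSum.tendsto_sum_nat) ?_⟩
  simpa [Function.comp_def, hpart] using hr0.const_sub y

/-- A unital C*-algebra of real rank zero carried by a set of sets of natural numbers, together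
with a sequence which is `1 / 2`-dense in its unit ball. Up to isomorphism these are all nontrivial
separable unital C*-algebras of real rank zero. -/
structure SeparableRealRankZeroModel where
  carrier : Set (Set ℕ)
  [algebra : CStarAlgebra carrier]
  [nontrivial : Nontrivial carrier]
  realRankZero : RealRankZero carrier
  seq : ℕ → carrier
  norm_seq_le : ∀ n, ‖seq n‖ ≤ 1
  exists_seq_near : ∀ x : carrier, ‖x‖ ≤ 1 → ∃ n, ‖x - seq n‖ ≤ 1 / 2

attribute [instance] SeparableRealRankZeroModel.algebra SeparableRealRankZeroModel.nontrivial

namespace SeparableRealRankZeroModel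

/-- A separable metric space injects into the power set of the natural numbers. -/
theorem exists_injective_set_nat (X : Type*) [MetricSpace X] [Nonempty X]
    [TopologicalSpace.SeparableSpace X] : ∃ j : X → Set ℕ, Function.Injective j := by
  let d := TopologicalSpace.denseSeq X
  refine ⟨fun x ↦ {n | dist x (d n.unpair.1) < 1 / ((n.unpair.2 : ℝ) + 1)}, fun x y hxy ↦ ?_⟩
  refine eq_of_forall_dist_le fun ε hε ↦ ?_
  obtain ⟨k, hk⟩ := exists_nat_one_div_lt (half_pos hε)
  obtain ⟨m, hm⟩ := (TopologicalSpace.denseRange_denseSeq X).exists_dist_lt x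
    (Nat.one_div_pos_of_nat (α := ℝ) (n := k))
  have hy := (Set.ext_iff.1 hxy (Nat.pair m k)).1 (by simpa [d] using hm)
  have hy' : dist y (d m) < 1 / ((k : ℝ) + 1) := by simpa using hy
  have := dist_triangle_right x y (d m)
  have hm' : dist x (d m) < 1 / ((k : ℝ) + 1) := hm
  linarith

theorem exists_starAlgEquiv (X : Type*) [CStarAlgebra X] [Nontrivial X]
    [TopologicalSpace.SeparableSpace X] (hX : RealRankZero X) :
    ∃ i : SeparableRealRankZeroModel, Nonempty (i.carrier ≃⋆ₐ[ℂ] X) := by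
  obtain ⟨j, hj⟩ := exists_injective_set_nat X
  obtain ⟨_, ⟨e⟩⟩ := (Equiv.ofInjective j hj).symm.exists_cstarAlgebra_starAlgEquiv
  have : SecondCountableTopology X := UniformSpace.secondCountable_of_separable X
  have : Nonempty (Metric.closedBall (0 : X) 1) := ⟨⟨0, by simp⟩⟩
  let s := TopologicalSpace.denseSeq (Metric.closedBall (0 : X) 1)
  refine ⟨{ carrier := Set.range j
            nontrivial := e.toEquiv.nontrivial
            realRankZero := hX.of_starAlgEquiv e
            seq := fun n ↦ e.symm (s n)
            norm_seq_le := fun n ↦ ?_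
            exists_seq_near := fun x hx ↦ ?_ }, ⟨e⟩⟩
  · rw [StarAlgEquiv.norm_map]
    exact mem_closedBall_zero_iff.1 (s n).2
  · obtain ⟨n, hn⟩ := (TopologicalSpace.denseRange_denseSeq
      (Metric.closedBall (0 : X) 1)).exists_dist_lt ⟨e x, by simpa [StarAlgEquiv.norm_map] using hx⟩
      one_half_pos
    refine ⟨n, ?_⟩
    rw [← StarAlgEquiv.norm_map e]
    simpa [Subtype.dist_eq, dist_eq_norm] using hn.le

end SeparableRealRankZeroModel

/-- There is a universal separable unital C*-algebra of real rank zero: every separable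
unital C*-algebra of real rank zero is a quotient of it by a surjective unital
*-homomorphism. -/
theorem exists_universal_separable_realRankZero :
    ∃ (Z : Type) (_ : CStarAlgebra Z), TopologicalSpace.SeparableSpace Z ∧ RealRankZero Z ∧
      ∀ (X : Type) (_ : CStarAlgebra X), TopologicalSpace.SeparableSpace X → RealRankZero X →
        ∃ f : Z →⋆ₐ[ℂ] X, Function.Surjective f := by
  let A : SeparableRealRankZeroModel → Type := fun i ↦ i.carrier
  let s : ℕ → lp A ∞ := fun n ↦ ⟨fun i ↦ i.seq n, memℓp_infty ⟨1, by
    rintro _ ⟨i, rfl⟩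
    exact i.norm_seq_le n⟩⟩
  have hs : ∀ n, ‖s n‖ ≤ 1 := fun n ↦
    lp.norm_le_of_forall_le zero_le_one fun i ↦ i.norm_seq_le n
  obtain ⟨S, hS, hsS, hsep, hrr⟩ := (RealRankZero.lp_infty (A := A)
    fun i ↦ i.realRankZero).exists_separable_starSubalgebra (Set.countable_range s)
  refine ⟨S, inferInstance, hsep, hrr, fun X _ _ hX ↦ ?_⟩
  rcases subsingleton_or_nontrivial X with _ | _
  · exact ⟨{ toFun := 0
             map_one' := Subsingleton.elim _ _
             map_mul' := fun _ _ ↦ Subsingleton.elim _ _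
             map_zero' := rfl
             map_add' := fun _ _ ↦ Subsingleton.elim _ _
             commutes' := fun _ ↦ Subsingleton.elim _ _
             map_star' := fun _ ↦ Subsingleton.elim _ _ }, fun x ↦ ⟨0, Subsingleton.elim _ _⟩⟩
  obtain ⟨i, ⟨e⟩⟩ := SeparableRealRankZeroModel.exists_starAlgEquiv X hX
  refine ⟨(e : A i →⋆ₐ[ℂ] X).comp ((lp.evalStarAlgHom A i).comp S.subtype), ?_⟩
  refine e.surjective.comp ?_
  refine ContinuousLinearMap.surjective_of_approx_preimage
    ((lp.evalCLM ℂ A ∞ i).comp S.toSubalgebra.toSubmodule.subtypeL) 1 zero_le_one fun y ↦ ?_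
  rcases eq_or_ne y 0 with rfl | hy
  · exact ⟨0, by simp⟩
  have hy0 : 0 < ‖y‖ := norm_pos_iff.2 hy
  obtain ⟨n, hn⟩ := i.exists_seq_near ((‖y‖⁻¹ : ℂ) • y) (by
    rw [norm_smul, norm_inv, Complex.norm_real, norm_norm, inv_mul_cancel₀ hy0.ne'])
  refine ⟨(‖y‖ : ℂ) • ⟨s n, hsS ⟨n, rfl⟩⟩, ?_, ?_⟩
  · change ‖y - (‖y‖ : ℂ) • i.seq n‖ ≤ _
    have : y - (‖y‖ : ℂ) • i.seq n = (‖y‖ : ℂ) • ((‖y‖⁻¹ : ℂ) • y - i.seq n) := by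
      rw [smul_sub, smul_smul, mul_inv_cancel₀ (by exact_mod_cast hy0.ne'), one_smul]
    rw [this, norm_smul, Complex.norm_real, norm_norm, mul_comm]
    gcongr
  · rw [norm_smul, Complex.norm_real, norm_norm, one_mul]
    exact mul_le_of_le_one_right hy0.le (hs n)
end

section
/- Let τ be an infinite cardinal, let X be a unital C*-algebra of real rank zero, and let S ⊆ X be a subset with |S| ≤ τ. Then there exists a topologically closed unital star-subalgebra B of X such that S ⊆ B, B has a dense subset of cardinality at most τ, and B (with the induced norm and operations, as a unital C*-algebra in its own right) has real rank zero. -/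
open Cardinal

open Set in
/-- A set of cardinality at most an infinite cardinal `τ` is contained in a set of cardinality at
most `τ` that is closed under a given countable family of binary operations. -/
theorem exists_superset_card_le_forall_mem {X : Type*} {τ : Cardinal} (hτ : ℵ₀ ≤ τ)
    {G : Set (X → X → X)} (hG : G.Countable) (S : Set X) (hS : #S ≤ τ) :
    ∃ T : Set X, S ⊆ T ∧ #T ≤ τ ∧ ∀ g ∈ G, ∀ x ∈ T, ∀ y ∈ T, g x y ∈ T := by
  let step : Set X → Set X := fun T ↦ T ∪ ⋃ g : G, image2 g.1 T T
  have subset_step (T : Set X) : T ⊆ step T := subset_union_left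
  have card_step (T : Set X) (hT : #T ≤ τ) : #(step T) ≤ τ := by
    refine (mk_union_le _ _).trans (add_le_of_le hτ hT ?_)
    refine (mk_iUnion_le _).trans (mul_le_of_le hτ ((le_aleph0_iff_set_countable.2 hG).trans hτ) ?_)
    refine ciSup_le' fun g ↦ ?_
    rw [← image_prod]
    refine mk_image_le.trans ?_
    rw [mk_setProd]
    exact mul_le_of_le hτ hT hT
  let T : ℕ → Set X := fun n ↦ step^[n] S
  have T_succ (n : ℕ) : T (n + 1) = step (T n) := Function.iterate_succ_apply' step n S
  have T_mono : Monotone T := monotone_nat_of_le_succ fun n ↦ by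
    rw [T_succ]
    exact subset_step _
  have card_T (n : ℕ) : #(T n) ≤ τ := by
    induction n with
    | zero => exact hS
    | succ n ih =>
      rw [T_succ]
      exact card_step _ ih
  refine ⟨⋃ n, T n, subset_iUnion T 0, ?_, fun g hg x hx y hy ↦ ?_⟩
  · have h := mk_iUnion_le_lift T
    simp only [mk_nat, lift_aleph0, lift_uzero] at h
    exact h.trans (mul_le_of_le hτ hτ (ciSup_le' card_T))
  · obtain ⟨m, hm⟩ := mem_iUnion.1 hx
    obtain ⟨n, hn⟩ := mem_iUnion.1 hy
    refine mem_iUnion.2 ⟨max m n + 1, ?_⟩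
    rw [T_succ]
    exact Or.inr (mem_iUnion.2 ⟨⟨g, hg⟩, mem_image2_of_mem (T_mono (le_max_left m n) hm)
      (T_mono (le_max_right m n) hn)⟩)

/-- The closure of a set closed under the ring operations, the involution and a dense set of
scalars, as a star subalgebra. -/
def StarSubalgebra.closureOfDenseScalars {X : Type*} [CStarAlgebra X] (T : Set X) {Q : Set ℂ}
    (hQ : Dense Q) (one_mem : 1 ∈ T) (add_mem : ∀ x ∈ T, ∀ y ∈ T, x + y ∈ T)
    (mul_mem : ∀ x ∈ T, ∀ y ∈ T, x * y ∈ T) (star_mem : ∀ x ∈ T, star x ∈ T)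
    (smul_mem : ∀ c ∈ Q, ∀ x ∈ T, c • x ∈ T) : StarSubalgebra ℂ X :=
  have smul_closure (c : ℂ) {x : X} (hx : x ∈ closure T) : c • x ∈ closure T :=
    map_mem_closure₂ continuous_smul (hQ c) hx smul_mem
  { carrier := closure T
    mul_mem' := fun hx hy ↦ map_mem_closure₂ continuous_mul hx hy mul_mem
    add_mem' := fun hx hy ↦ map_mem_closure₂ continuous_add hx hy add_mem
    star_mem' := fun hx ↦ map_mem_closure continuous_star hx star_mem
    algebraMap_mem' := fun c ↦ by
      rw [Algebra.algebraMap_eq_smul_one]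
      exact smul_closure c (subset_closure one_mem) }

open ComplexStarModule in
/-- A closed star subalgebra has real rank zero if it has a dense subset such that the real part
of each of its elements is approximated by invertible self-adjoint elements of the subalgebra. -/
theorem RealRankZero.of_subset_closure {X : Type*} [CStarAlgebra X] {B : StarSubalgebra ℂ X}
    (hB : IsClosed (B : Set X)) {T : Set X} (hT : (B : Set X) ⊆ closure T)
    (h : ∀ x ∈ T, ∀ ε : ℝ, 0 < ε →
      ∃ y ∈ B, IsSelfAdjoint y ∧ IsUnit y ∧ ‖(ℜ x : X) - y‖ < ε) :
    RealRankZero B := by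
  intro x hx ε hε
  obtain ⟨t, ht, hxt⟩ := Metric.mem_closure_iff.1 (hT x.2) (ε / 2) (half_pos hε)
  obtain ⟨y, hyB, hy, hyu, hty⟩ := h t ht (ε / 2) (half_pos hε)
  have hx' : IsSelfAdjoint (x : X) := congrArg Subtype.val hx
  refine ⟨⟨y, hyB⟩, Subtype.ext hy, ?_, ?_⟩
  · have : IsClosed (B : Set X) := hB
    exact (StarSubalgebra.coe_isUnit (S := B)).1 hyu
  · have hxt' : ‖(x : X) - ℜ t‖ < ε / 2 := by
      calc ‖(x : X) - ℜ t‖ = ‖(ℜ ((x : X) - t) : X)‖ := by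
            rw [map_sub, AddSubgroupClass.coe_sub, hx'.coe_realPart]
        _ ≤ ‖(x : X) - t‖ := realPart.norm_le ((x : X) - t)
        _ < ε / 2 := by rwa [← dist_eq_norm]
    calc ‖(x : X) - y‖ ≤ ‖(x : X) - ℜ t‖ + ‖(ℜ t : X) - y‖ :=
          norm_sub_le_norm_sub_add_norm_sub _ _ _
      _ < ε := by linarith

open ComplexStarModule in
theorem exists_closed_starSubalgebra_realRankZero_of_card_le
    (τ : Cardinal) (hτ : ℵ₀ ≤ τ)
    (X : Type*) [CStarAlgebra X] (hX : RealRankZero X)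
    (S : Set X) (hS : #S ≤ τ) :
    ∃ B : StarSubalgebra ℂ X, IsClosed (B : Set X) ∧ S ⊆ B ∧
      (∃ D : Set B, Dense D ∧ #D ≤ τ) ∧ RealRankZero B := by
  have approx (n : ℕ) (x : X) : ∃ y : X, IsSelfAdjoint y ∧ IsUnit y ∧
      ‖(ℜ x : X) - y‖ < 1 / ((n : ℝ) + 1) :=
    hX _ (ℜ x).2 _ Nat.one_div_pos_of_nat
  choose f f_selfAdjoint f_isUnit f_lt using approx
  obtain ⟨Q, hQc, hQ⟩ := TopologicalSpace.exists_countable_dense ℂ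
  let G : Set (X → X → X) := {fun x y ↦ x + y, fun x y ↦ x * y, fun x _ ↦ star x} ∪
    ((fun (c : ℂ) (x _ : X) ↦ c • x) '' Q ∪ Set.range fun n x _ ↦ f n x)
  have hG : G.Countable :=
    (Set.toFinite _).countable.union ((hQc.image _).union (Set.countable_range _))
  obtain ⟨T, hST, hTc, hT⟩ := exists_superset_card_le_forall_mem hτ hG (insert 1 S)
    (mk_insert_le.trans (add_le_of_le hτ hS (one_le_aleph0.trans hτ)))
  have f_mem (n : ℕ) (x : X) (hx : x ∈ T) : f n x ∈ T :=
    hT _ (.inr (.inr ⟨n, rfl⟩)) x hx x hx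
  let B : StarSubalgebra ℂ X := .closureOfDenseScalars T hQ (hST (Set.mem_insert _ _))
    (hT _ (.inl (by simp))) (hT _ (.inl (by simp)))
    (fun x hx ↦ hT (fun x _ ↦ star x) (.inl (by simp)) x hx x hx)
    (fun c hc x hx ↦ hT _ (.inr (.inl ⟨c, hc, rfl⟩)) x hx x hx)
  have hTB : T ⊆ B := subset_closure
  have hB : IsClosed (B : Set X) := isClosed_closure
  refine ⟨B, hB, ((Set.subset_insert _ _).trans hST).trans hTB, ⟨Subtype.val ⁻¹' T, ?_, ?_⟩,
    .of_subset_closure hB subset_rfl fun x hx ε hε ↦ ?_⟩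
  · exact Subtype.dense_iff.2 (closure_mono fun x hx ↦ ⟨⟨x, hTB hx⟩, hx, rfl⟩)
  · exact (mk_preimage_of_injective _ _ Subtype.val_injective).trans hTc
  · obtain ⟨n, hn⟩ := exists_nat_one_div_lt hε
    exact ⟨f n x, hTB (f_mem n x hx), f_selfAdjoint n x, f_isUnit n x, (f_lt n x).trans hn⟩
end

section
/- Let X be a unital C*-algebra of real rank zero and let S ⊆ X be a countable subset. Then there exists a separable topologically closed unital star-subalgebra B of X with S ⊆ B such that B has real rank zero. -/
open ComplexStarModule in
/-- In a unital C*-algebra of real rank zero, the real part of every element is approximated by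
invertible self-adjoint elements. -/
theorem RealRankZero.exists_norm_realPart_sub_lt {X : Type*} [CStarAlgebra X]
    (hX : RealRankZero X) (x : X) {ε : ℝ} (hε : 0 < ε) :
    ∃ y : X, IsSelfAdjoint y ∧ IsUnit y ∧ ‖(ℜ x : X) - y‖ < ε :=
  hX _ (ℜ x).2 ε hε

/-- Every countable set is contained in a countable set closed under a given countable family of
binary operations. -/
theorem Set.Countable.exists_countable_superset_closed {α : Type*} {S : Set α} (hS : S.Countable)
    {O : Set (α → α → α)} (hO : O.Countable) :
    ∃ C : Set α, C.Countable ∧ S ⊆ C ∧ ∀ f ∈ O, ∀ x ∈ C, ∀ y ∈ C, f x y ∈ C := by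
  let F : ℕ → Set α := fun n ↦
    Nat.rec S (fun _ A ↦ A ∪ ⋃ f ∈ O, Set.image2 f A A) n
  have hF : ∀ n, F (n + 1) = F n ∪ ⋃ f ∈ O, Set.image2 f (F n) (F n) := fun _ ↦ rfl
  have hmono : Monotone F := monotone_nat_of_le_succ fun n ↦ by
    rw [hF]
    exact Set.subset_union_left
  have hcount : ∀ n, (F n).Countable := by
    intro n
    induction n with
    | zero => exact hS
    | succ n ih => exact ih.union (hO.biUnion fun f _ ↦ ih.image2 ih f)
  refine ⟨⋃ n, F n, Set.countable_iUnion hcount, Set.subset_iUnion F 0, ?_⟩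
  intro f hf x hx y hy
  obtain ⟨m, hm⟩ := Set.mem_iUnion.1 hx
  obtain ⟨n, hn⟩ := Set.mem_iUnion.1 hy
  refine Set.mem_iUnion.2 ⟨max m n + 1, ?_⟩
  rw [hF]
  exact Or.inr (Set.mem_biUnion hf (Set.mem_image2_of_mem (hmono (le_max_left m n) hm)
    (hmono (le_max_right m n) hn)))

open ComplexStarModule in
theorem exists_separable_closed_starSubalgebra_realRankZero
    (X : Type*) [CStarAlgebra X] (hX : RealRankZero X)
    (S : Set X) (hS : S.Countable) :
    ∃ B : StarSubalgebra ℂ X, IsClosed (B : Set X) ∧ S ⊆ B ∧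
      TopologicalSpace.SeparableSpace B ∧ RealRankZero B := by
  choose g hg_sa hg_unit hg_lt using fun (n : ℕ) (x : X) ↦
    hX.exists_norm_realPart_sub_lt x (Nat.one_div_pos_of_nat (α := ℝ) (n := n))
  obtain ⟨C, hC, hSC, hop⟩ := (hS.insert 1).exists_countable_superset_closed
    (O := {fun x y ↦ x + y, fun x y ↦ x * y, fun x _ ↦ star x} ∪
      (Set.range (fun (k : ℕ) (x _ : X) ↦ TopologicalSpace.denseSeq ℂ k • x) ∪
        Set.range (fun (n : ℕ) (x _ : X) ↦ g n x)))
    ((Set.toFinite _).countable.union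
      ((Set.countable_range _).union (Set.countable_range _)))
  have hadd : ∀ x ∈ C, ∀ y ∈ C, x + y ∈ C := hop _ (by simp)
  have hmul : ∀ x ∈ C, ∀ y ∈ C, x * y ∈ C := hop _ (by simp)
  have hstar : ∀ x ∈ C, star x ∈ C := fun x hx ↦ hop (fun x _ ↦ star x) (by simp) x hx x hx
  have hsmul : ∀ r ∈ Set.range (TopologicalSpace.denseSeq ℂ), ∀ x ∈ C, r • x ∈ C := by
    rintro _ ⟨k, rfl⟩ x hx
    exact hop _ (Or.inr (Or.inl ⟨k, rfl⟩)) x hx x hx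
  have hg : ∀ n, ∀ x ∈ C, g n x ∈ C := fun n x hx ↦
    hop _ (Or.inr (Or.inr ⟨n, rfl⟩)) x hx x hx
  have hsmul' : ∀ (r : ℂ), ∀ x ∈ closure C, r • x ∈ closure C := fun r x hx ↦
    map_mem_closure₂ continuous_smul (TopologicalSpace.denseRange_denseSeq ℂ r) hx hsmul
  have hone : (1 : X) ∈ closure C := subset_closure (hSC (Set.mem_insert _ _))
  let B : StarSubalgebra ℂ X :=
    { carrier := closure C
      mul_mem' := fun ha hb ↦ map_mem_closure₂ continuous_mul ha hb hmul
      add_mem' := fun ha hb ↦ map_mem_closure₂ continuous_add ha hb hadd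
      algebraMap_mem' := fun r ↦ by
        rw [Algebra.algebraMap_eq_smul_one]
        exact hsmul' r 1 hone
      star_mem' := fun ha ↦ map_mem_closure continuous_star ha hstar }
  have hB : IsClosed (B : Set X) := isClosed_closure
  refine ⟨B, hB, fun x hx ↦ subset_closure (hSC (Set.mem_insert_of_mem _ hx)),
    hC.isSeparable.closure.separableSpace, ?_⟩
  intro x hx ε hε
  have hx' : IsSelfAdjoint (x : X) := congrArg Subtype.val hx
  obtain ⟨c, hc, hxc⟩ := Metric.mem_closure_iff.1 (show (x : X) ∈ closure C from x.2) _
    (half_pos hε)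
  obtain ⟨n, hn⟩ := exists_nat_one_div_lt (half_pos hε)
  refine ⟨⟨g n c, subset_closure (hg n c hc)⟩, Subtype.ext (hg_sa n c), ?_, ?_⟩
  · exact (StarSubalgebra.coe_isUnit B (hS := hB)).1 (hg_unit n c)
  · have h₁ : ‖(x : X) - ℜ c‖ < ε / 2 := by
      have : (x : X) - ℜ c = ℜ ((x : X) - c) := by
        rw [map_sub, AddSubgroupClass.coe_sub, hx'.coe_realPart]
      rw [this]
      exact (realPart.norm_le ((x : X) - c)).trans_lt (by rwa [← dist_eq_norm])
    calc ‖(x : X) - g n c‖ ≤ ‖(x : X) - ℜ c‖ + ‖(ℜ c : X) - g n c‖ :=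
          norm_sub_le_norm_sub_add_norm_sub _ _ _
      _ < ε / 2 + ε / 2 := add_lt_add h₁ ((hg_lt n c).trans hn)
      _ = ε := add_halves ε
end

section
/- Let X be a unital C*-algebra and let 𝒞 be a nonempty collection of topologically closed unital star-subalgebras of X which is directed by inclusion (for any B₁, B₂ ∈ 𝒞 there is B₃ ∈ 𝒞 with B₁ ⊆ B₃ and B₂ ⊆ B₃), such that each member of 𝒞 has real rank zero and the union ⋃𝒞 is dense in X. Then X has real rank zero. -/
theorem realRankZero_of_directed_union_dense
    (X : Type*) [CStarAlgebra X]
    (𝒞 : Set (StarSubalgebra ℂ X)) (hne : 𝒞.Nonempty)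
    (hclosed : ∀ B ∈ 𝒞, IsClosed (B : Set X))
    (hdir : ∀ B₁ ∈ 𝒞, ∀ B₂ ∈ 𝒞, ∃ B₃ ∈ 𝒞, B₁ ≤ B₃ ∧ B₂ ≤ B₃)
    (hrr : ∀ B ∈ 𝒞, RealRankZero B)
    (hdense : Dense (⋃ B ∈ 𝒞, (B : Set X))) :
    RealRankZero X := by
  intro x hx ε hε
  obtain ⟨b, hb, hxb⟩ := hdense.exists_dist_lt x (half_pos hε)
  obtain ⟨B, hB, hbB⟩ := Set.mem_iUnion₂.mp hb
  rw [dist_eq_norm] at hxb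
  let a : B := realPart (⟨b, hbB⟩ : B)
  have hab : (a : X) = realPart b := by simp [a, realPart_apply_coe]
  have hxa : ‖x - a‖ < ε / 2 := by
    have h : x - a = realPart (x - b) := by simp [hab, hx.coe_realPart]
    rw [h]
    exact (realPart.norm_le (x - b)).trans_lt hxb
  obtain ⟨y, hy, hyu, hay⟩ := hrr B hB a (realPart _).2 (ε / 2) (half_pos hε)
  refine ⟨y, hy.map B.subtype, hyu.map B.subtype, ?_⟩
  calc ‖x - (y : X)‖ ≤ ‖x - a‖ + ‖(a : X) - y‖ := norm_sub_le_norm_sub_add_norm_sub _ _ _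
    _ < ε / 2 + ε / 2 := add_lt_add hxa hay
    _ = ε := add_halves ε
end

section
/- Let X be a unital C*-algebra, let A be a directed partially ordered set in which every countable subset has an upper bound, and let (B_α)_{α ∈ A} be a monotone family of topologically closed unital star-subalgebras of X (α ≤ β implies B_α ⊆ B_β) whose union ⋃_{α ∈ A} B_α is dense in X. Then ⋃_{α ∈ A} B_α = X; that is, the union is already closed and every element of X lies in some B_α. -/
theorem iUnion_eq_univ_of_dense_monotone_union
    (X : Type*) [CStarAlgebra X]
    (A : Type*) [PartialOrder A]
    (hdir : ∀ a b : A, ∃ c : A, a ≤ c ∧ b ≤ c)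
    (hcount : ∀ s : Set A, s.Countable → ∃ ub : A, ∀ a ∈ s, a ≤ ub)
    (B : A → StarSubalgebra ℂ X)
    (hclosed : ∀ α : A, IsClosed (B α : Set X))
    (hmono : ∀ α β : A, α ≤ β → B α ≤ B β)
    (hdense : Dense (⋃ α : A, (B α : Set X))) :
    (⋃ α : A, (B α : Set X)) = Set.univ := by
  refine Set.eq_univ_of_forall fun x => ?_
  obtain ⟨u, hu, hux⟩ := mem_closure_iff_seq_limit.1 (hdense x)
  choose a ha using fun n => Set.mem_iUnion.1 (hu n)
  obtain ⟨b, hb⟩ := hcount (Set.range a) (Set.countable_range a)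
  exact Set.mem_iUnion.2 ⟨b, (hclosed b).mem_of_tendsto hux
    (.of_forall fun n => hmono _ _ (hb _ (Set.mem_range_self n)) (ha n))⟩
end

section
/- Let X be a unital C*-algebra, let A be a directed partially ordered set in which every countable subset has an upper bound, and let (B_α)_{α ∈ A} be a monotone family of topologically closed unital star-subalgebras of X (α ≤ β implies B_α ⊆ B_β) with ⋃_{α ∈ A} B_α = X. Then for every separable unital C*-algebra S and every unital *-homomorphism f : S → X there exists α ∈ A such that the range of f is contained in B_α. -/
theorem exists_index_range_subset_of_monotone_union
    (X : Type*) [CStarAlgebra X]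
    (A : Type*) [PartialOrder A]
    (hdir : ∀ a b : A, ∃ c : A, a ≤ c ∧ b ≤ c)
    (hcount : ∀ s : Set A, s.Countable → ∃ ub : A, ∀ a ∈ s, a ≤ ub)
    (B : A → StarSubalgebra ℂ X)
    (hclosed : ∀ α : A, IsClosed (B α : Set X))
    (hmono : ∀ α β : A, α ≤ β → B α ≤ B β)
    (hunion : (⋃ α : A, (B α : Set X)) = Set.univ)
    (S : Type*) [CStarAlgebra S] [TopologicalSpace.SeparableSpace S]
    (f : S →⋆ₐ[ℂ] X) :
    ∃ α : A, Set.range f ⊆ (B α : Set X) := by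
  have hmem : ∀ x : X, ∃ α : A, x ∈ B α := fun x => by
    simpa using hunion.symm.subset (Set.mem_univ x)
  choose index hindex using hmem
  obtain ⟨D, hDcount, hDdense⟩ := TopologicalSpace.exists_countable_dense S
  obtain ⟨α, hα⟩ := hcount ((fun d => index (f d)) '' D) (hDcount.image _)
  have hfcont : Continuous f :=
    AddMonoidHomClass.continuous_of_bound f 1 fun x => by
      simpa using NonUnitalStarAlgHom.norm_apply_le f x
  have hfD : f '' D ⊆ (B α : Set X) := by
    rintro _ ⟨d, hd, rfl⟩
    exact hmono _ _ (hα _ (Set.mem_image_of_mem _ hd)) (hindex (f d))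
  exact ⟨α, (hfcont.range_subset_closure_image_dense hDdense).trans
    (closure_minimal hfD (hclosed α))⟩
end

section
/- Let τ be an infinite cardinal, let X be a unital C*-algebra of real rank zero, and let Y ⊆ X be a dense subset. Let exp_τ Y denote the partially ordered set of all subsets of Y of cardinality at most τ, ordered by inclusion. Then the set A' = {α ∈ exp_τ Y : the topological closure of the unital star-subalgebra of X generated by α has real rank zero} is cofinal and τ-closed in exp_τ Y; here a chain in exp_τ Y of cardinality at most τ has its union as least upper bound. -/
open Cardinal

universe u

/-- It suffices to approximate the self-adjoint elements of a dense star-subalgebra, and the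
invertibility of the approximants may be tested in the ambient C*-algebra. -/
theorem realRankZero_topologicalClosure_of_approx {X : Type*} [CStarAlgebra X]
    (S : StarSubalgebra ℂ X)
    (h : ∀ z ∈ S, IsSelfAdjoint z → ∀ ε : ℝ, 0 < ε →
      ∃ y ∈ S.topologicalClosure, IsSelfAdjoint y ∧ IsUnit y ∧ ‖z - y‖ < ε) :
    RealRankZero S.topologicalClosure := by
  rintro ⟨x, hx⟩ hxsa ε hε
  have hxsa' : IsSelfAdjoint x := congrArg Subtype.val hxsa
  obtain ⟨z, hz, hxz⟩ := Metric.mem_closure_iff.mp hx (ε / 2) (half_pos hε)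
  have hzre : (realPart z : X) ∈ S := by
    rw [realPart_apply_coe, ← Complex.coe_smul]
    exact S.smul_mem (add_mem hz (star_mem hz)) _
  have hxzre : ‖x - realPart z‖ < ε / 2 := by
    calc ‖x - realPart z‖ = ‖realPart (x - z)‖ := by
          rw [map_sub, ← AddSubgroup.norm_coe, AddSubgroupClass.coe_sub, hxsa'.coe_realPart]
      _ ≤ ‖x - z‖ := realPart.norm_le _
      _ < ε / 2 := by rwa [← dist_eq_norm]
  obtain ⟨y, hy, hysa, hyu, hzy⟩ := h _ hzre (realPart z).2 (ε / 2) (half_pos hε)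
  have : IsClosed (S.topologicalClosure : Set X) := S.isClosed_topologicalClosure
  refine ⟨⟨y, hy⟩, Subtype.ext hysa, (StarSubalgebra.coe_isUnit _).mp hyu, ?_⟩
  calc ‖x - y‖ ≤ ‖x - realPart z‖ + ‖(realPart z : X) - y‖ := norm_sub_le_norm_sub_add_norm_sub ..
    _ < ε := by linarith

theorem exists_mem_adjoin_of_mem_adjoin_iUnion {X ι : Type*} [CStarAlgebra X] [Nonempty ι]
    {α : ι → Set X} (hα : Directed (· ⊆ ·) α) {z : X}
    (hz : z ∈ StarAlgebra.adjoin ℂ (⋃ i, α i)) : ∃ i, z ∈ StarAlgebra.adjoin ℂ (α i) := by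
  have hmono {i j : ι} (h : α i ⊆ α j) := StarAlgebra.adjoin_mono (R := ℂ) h
  induction hz using StarAlgebra.adjoin_induction with
  | mem x hx =>
    obtain ⟨i, hi⟩ := Set.mem_iUnion.mp hx
    exact ⟨i, StarAlgebra.subset_adjoin ℂ _ hi⟩
  | algebraMap r => exact ⟨Classical.arbitrary ι, algebraMap_mem _ r⟩
  | add x y _ _ hx hy =>
    obtain ⟨⟨i, hi⟩, j, hj⟩ := And.intro hx hy
    obtain ⟨k, hik, hjk⟩ := hα i j
    exact ⟨k, add_mem (hmono hik hi) (hmono hjk hj)⟩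
  | mul x y _ _ hx hy =>
    obtain ⟨⟨i, hi⟩, j, hj⟩ := And.intro hx hy
    obtain ⟨k, hik, hjk⟩ := hα i j
    exact ⟨k, mul_mem (hmono hik hi) (hmono hjk hj)⟩
  | star x _ hx =>
    obtain ⟨i, hi⟩ := hx
    exact ⟨i, star_mem hi⟩

theorem exists_mk_le_adjoin_subset_closure {X : Type u} [CStarAlgebra X] {τ : Cardinal.{u}}
    (hτ : ℵ₀ ≤ τ) {α : Set X} (hα : #α ≤ τ) :
    ∃ D : Set X, #D ≤ τ ∧ (StarAlgebra.adjoin ℂ α : Set X) ⊆ closure D := by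
  obtain ⟨Q, hQc, hQd⟩ := TopologicalSpace.exists_countable_dense ℂ
  set G : Set X := (α ∪ star α) ∪ algebraMap ℂ X '' Q with hG
  have hGcard : #G ≤ τ := by
    have hstar : #(star α : Set X) ≤ τ := by
      rw [← Set.image_star]
      exact mk_image_le.trans hα
    have hscalar : #(algebraMap ℂ X '' Q) ≤ τ := (hQc.image _).le_aleph0.trans hτ
    exact (mk_union_le _ _).trans (add_le_of_le hτ
      ((mk_union_le _ _).trans (add_le_of_le hτ hα hstar)) hscalar)
  refine ⟨Algebra.adjoin ℤ G, ?_, fun z hz => ?_⟩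
  · have h := Algebra.lift_cardinalMk_adjoin_le ℤ G
    simp only [mk_int, lift_aleph0, lift_uzero] at h
    exact h.trans (sup_le (sup_le hτ hGcard) hτ)
  · change z ∈ (Algebra.adjoin ℤ G).topologicalClosure
    have hsub : G ⊆ (Algebra.adjoin ℤ G).topologicalClosure :=
      Algebra.subset_adjoin.trans (Subalgebra.le_topologicalClosure _)
    replace hz : z ∈ Algebra.adjoin ℂ (α ∪ star α) := hz
    induction hz using Algebra.adjoin_induction with
    | mem x hx => exact hsub (Or.inl hx)
    | algebraMap r =>
      refine (Subalgebra.isClosed_topologicalClosure _).closure_subset_iff.mpr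
        (Set.subset_union_right.trans hsub) ?_
      exact image_closure_subset_closure_image (algebraMapCLM ℂ X).continuous ⟨r, hQd r, rfl⟩
    | add x y _ _ hx hy => exact add_mem hx hy
    | mul x y _ _ hx hy => exact mul_mem hx hy

theorem exists_superset_approx {X : Type u} [CStarAlgebra X] (hX : RealRankZero X)
    {Y : Set X} (hY : Dense Y) {τ : Cardinal.{u}} (hτ : ℵ₀ ≤ τ) {α : Set X}
    (hαY : α ⊆ Y) (hα : #α ≤ τ) :
    ∃ β : Set X, (β ⊆ Y ∧ #β ≤ τ) ∧ α ⊆ β ∧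
      ∀ z ∈ StarAlgebra.adjoin ℂ α, IsSelfAdjoint z → ∀ ε : ℝ, 0 < ε →
        ∃ y ∈ closure β, IsSelfAdjoint y ∧ IsUnit y ∧ ‖z - y‖ < ε := by
  obtain ⟨D, hD, hDα⟩ := exists_mk_le_adjoin_subset_closure hτ hα
  choose y hysa hyu hy using fun (d : X) (n : ℕ) =>
    hX (realPart d) (realPart d).2 (1 / (n + 1)) Nat.one_div_pos_of_nat
  choose F hFY hF using fun (d : X) (n : ℕ) => mem_closure_iff_seq_limit.mp (hY (y d n))
  refine ⟨α ∪ Set.range fun p : D × ℕ × ℕ => F p.1 p.2.1 p.2.2, ⟨?_, ?_⟩,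
    Set.subset_union_left, fun z hz hzsa ε hε => ?_⟩
  · exact Set.union_subset hαY (Set.range_subset_iff.mpr fun p => hFY _ _ _)
  · refine (mk_union_le _ _).trans (add_le_of_le hτ hα (mk_range_le.trans ?_))
    rw [mk_prod, lift_uzero]
    refine mul_le_of_le hτ hD ?_
    simpa using hτ
  · obtain ⟨d, hd, hzd⟩ := Metric.mem_closure_iff.mp (hDα hz) (ε / 2) (half_pos hε)
    obtain ⟨n, hn⟩ := exists_nat_one_div_lt (half_pos hε)
    refine ⟨y d n, ?_, hysa d n, hyu d n, ?_⟩
    · refine mem_closure_of_tendsto (hF d n) (Filter.Eventually.of_forall fun k => Or.inr ?_)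
      exact ⟨(⟨d, hd⟩, n, k), rfl⟩
    · have hzre : ‖z - realPart d‖ < ε / 2 := by
        calc ‖z - realPart d‖ = ‖realPart (z - d)‖ := by
              rw [map_sub, ← AddSubgroup.norm_coe, AddSubgroupClass.coe_sub, hzsa.coe_realPart]
          _ ≤ ‖z - d‖ := realPart.norm_le _
          _ < ε / 2 := by rwa [← dist_eq_norm]
      calc ‖z - y d n‖ ≤ ‖z - realPart d‖ + ‖(realPart d : X) - y d n‖ :=
            norm_sub_le_norm_sub_add_norm_sub ..
        _ < ε := by linarith [hy d n]

theorem realRankZero_topologicalClosure_adjoin_empty (X : Type*) [CStarAlgebra X] :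
    RealRankZero (StarAlgebra.adjoin ℂ (∅ : Set X)).topologicalClosure := by
  refine realRankZero_topologicalClosure_of_approx _ fun z hz hzsa ε hε => ?_
  rw [show StarAlgebra.adjoin ℂ (∅ : Set X) = ⊥ from StarAlgebra.gc.l_bot] at hz ⊢
  obtain ⟨c, rfl⟩ := StarSubalgebra.mem_bot.mp hz
  rcases eq_or_ne c 0 with rfl | hc
  · refine ⟨algebraMap ℂ X (ε / 2 : ℝ), algebraMap_mem _ _, ?_, ?_, ?_⟩
    · exact IsSelfAdjoint.algebraMap X (Complex.conj_ofReal _)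
    · exact (IsUnit.mk0 _ (by exact_mod_cast (half_pos hε).ne')).map (algebraMap ℂ X)
    · rcases subsingleton_or_nontrivial X with _ | _
      · rwa [Subsingleton.elim (_ - _) (0 : X), norm_zero]
      · rw [map_zero, zero_sub, norm_neg, norm_algebraMap', Complex.norm_real, Real.norm_eq_abs,
          abs_of_pos (half_pos hε)]
        exact half_lt_self hε
  · exact ⟨_, algebraMap_mem _ _, hzsa, (IsUnit.mk0 c hc).map (algebraMap ℂ X), by simpa⟩

theorem realRankZero_topologicalClosure_adjoin_iUnion {X ι : Type*} [CStarAlgebra X]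
    [Nonempty ι] {α : ι → Set X} (hα : Directed (· ⊆ ·) α)
    (h : ∀ i, ∀ z ∈ StarAlgebra.adjoin ℂ (α i), IsSelfAdjoint z → ∀ ε : ℝ, 0 < ε →
      ∃ y ∈ (StarAlgebra.adjoin ℂ (⋃ i, α i)).topologicalClosure,
        IsSelfAdjoint y ∧ IsUnit y ∧ ‖z - y‖ < ε) :
    RealRankZero (StarAlgebra.adjoin ℂ (⋃ i, α i)).topologicalClosure := by
  refine realRankZero_topologicalClosure_of_approx _ fun z hz => ?_
  obtain ⟨i, hi⟩ := exists_mem_adjoin_of_mem_adjoin_iUnion hα hz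
  exact h i z hi

theorem cofinal_tauClosed_realRankZero_subalgebras
    (τ : Cardinal.{u}) (hτ : ℵ₀ ≤ τ)
    (X : Type u) [CStarAlgebra X] (hX : RealRankZero X)
    (Y : Set X) (hY : Dense Y) :
    -- `expτ` is the partially ordered set of all subsets of `Y` of cardinality at most `τ`,
    -- ordered by inclusion.
    let expτ : Type u := {α : Set X // α ⊆ Y ∧ #α ≤ τ}
    let A' : Set expτ :=
      {α : expτ | RealRankZero ((StarAlgebra.adjoin ℂ α.1).topologicalClosure : StarSubalgebra ℂ X)}
    -- `A'` is cofinal in `expτ` ...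
    (∀ a : expτ, ∃ b ∈ A', a ≤ b) ∧
    -- ... and `τ`-closed in `expτ`.
    (∀ C : Set expτ, C ⊆ A' → IsChain (· ≤ ·) C → #C ≤ τ →
      ∀ s : expτ, IsLUB C s → s ∈ A') := by
  intro expτ A'
  refine ⟨fun a => ?_, fun C hCA hC hCτ s hs => ?_⟩
  · choose next hnext hsub happrox using
      fun α : expτ => exists_superset_approx hX hY hτ α.2.1 α.2.2
    let seq (n : ℕ) : expτ := (fun α => ⟨next α, hnext α⟩)^[n] a
    have hseq (n : ℕ) : (seq (n + 1)).1 = next (seq n) := by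
      simp only [seq, Function.iterate_succ_apply']
    have hmono : Monotone fun n => (seq n).1 :=
      monotone_nat_of_le_succ fun n => (hsub (seq n)).trans_eq (hseq n).symm
    have hcard : #(⋃ n, (seq n).1 : Set X) ≤ τ := by
      have h := mk_iUnion_le_lift fun n => (seq n).1
      simp only [lift_uzero, mk_nat, lift_aleph0] at h
      exact h.trans (mul_le_of_le hτ hτ (ciSup_le' fun n => (seq n).2.2))
    refine ⟨⟨⋃ n, (seq n).1, Set.iUnion_subset fun n => (seq n).2.1, hcard⟩, ?_,
      Set.subset_iUnion (fun n => (seq n).1) 0⟩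
    refine realRankZero_topologicalClosure_adjoin_iUnion hmono.directed_le
      fun n z hz hzsa ε hε => ?_
    obtain ⟨y, hy, hy'⟩ := happrox (seq n) z hz hzsa ε hε
    refine ⟨y, closure_mono ?_ hy, hy'⟩
    rw [← hseq n]
    exact (Set.subset_iUnion (fun n => (seq n).1) (n + 1)).trans (StarAlgebra.subset_adjoin ℂ _)
  · have hcard : #(⋃ α : C, α.1.1 : Set X) ≤ τ :=
      (mk_iUnion_le _).trans (mul_le_of_le hτ hCτ (ciSup_le' fun α => α.1.2.2))
    have hs_eq : s.1 = ⋃ α : C, α.1.1 := by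
      refine subset_antisymm ?_ (Set.iUnion_subset fun α => hs.1 α.2)
      have hub : (⟨_, Set.iUnion_subset fun α : C => α.1.2.1, hcard⟩ : expτ) ∈ upperBounds C :=
        fun α hα => Set.subset_iUnion (fun α : C => α.1.1) ⟨α, hα⟩
      exact hs.2 hub
    change RealRankZero (StarAlgebra.adjoin ℂ s.1).topologicalClosure
    rw [hs_eq]
    rcases isEmpty_or_nonempty C with hne | hne
    · rw [Set.iUnion_of_empty]
      exact realRankZero_topologicalClosure_adjoin_empty X
    · refine realRankZero_topologicalClosure_adjoin_iUnion ?_ fun α z hz hzsa ε hε => ?_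
      · exact fun α β => hC.directed α β
      · obtain ⟨y, hysa, hyu, hy⟩ := hCA α.2
          ⟨z, StarSubalgebra.le_topologicalClosure _ hz⟩ (Subtype.ext hzsa) ε hε
        refine ⟨y, StarSubalgebra.topologicalClosure_mono (StarAlgebra.adjoin_mono
          (Set.subset_iUnion (fun α : C => α.1.1) α)) y.2, congrArg Subtype.val hysa, ?_, hy⟩
        exact hyu.map (StarSubalgebra.subtype _)
end
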